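/- arXiv:2105.06128 — 2 statements merged into one kernel-verified Lean document; each statement's English description precedes it below -/
import Mathlib

section
/- Let G be a locally profinite group, k a field, and U₁, U₂ compact open subgroups of G. For a compact open subgroup U of G, let C_c(G/U,k) ⊆ C_c^∞(G,k) denote the subspace of compactly supported functions f : G → k with f(gu) = f(g) for all g ∈ G, u ∈ U; G acts on these spaces by left translation (g ·_ℓ f)(x) = f(g⁻¹x). Then every k-linear map ρ : C_c(G/U₁,k) → C_c(G/U₂,k) commuting with left translation by all elements of G is the restriction to C_c(G/U₁,k) of some k-linear endomorphism ρ̃ of C_c^∞(G,k) that commutes with left translation by all elements of G. -/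
/-- The space `C_c^∞(G,k)` of locally constant compactly supported `k`-valued functions,
as a `k`-submodule of `G → k`. -/
def SmoothCc (k G : Type*) [Field k] [TopologicalSpace G] : Submodule k (G → k) where
  carrier := {f | IsLocallyConstant f ∧ HasCompactSupport f}
  add_mem' := fun hf hg => ⟨hf.1.add hg.1, hf.2.add hg.2⟩
  zero_mem' := ⟨IsLocallyConstant.const 0, by
    rw [HasCompactSupport, tsupport]
    simp⟩
  smul_mem' := fun c f hf => ⟨hf.1.comp (c * ·), by
    have h := HasCompactSupport.smul_left (f := fun _ : G => c) hf.2
    exact h⟩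

/-- The space `C_c(G/U,k)` of compactly supported functions `f : G → k` with
`f(gu) = f(g)` for all `u ∈ U` (for `U` open these are automatically locally constant,
so `C_c(G/U,k) ⊆ C_c^∞(G,k)`), as a `k`-submodule of `G → k`. -/
def RightInvCc (k : Type*) (G : Type*) [Field k] [Group G] [TopologicalSpace G]
    (U : Subgroup G) : Submodule k (G → k) where
  carrier := {f | HasCompactSupport f ∧ ∀ g : G, ∀ u ∈ U, f (g * u) = f g}
  add_mem' := fun hf hg => ⟨hf.1.add hg.1, fun g u hu => by
    simp only [Pi.add_apply, hf.2 g u hu, hg.2 g u hu]⟩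
  zero_mem' := ⟨by rw [HasCompactSupport, tsupport]; simp, fun _ _ _ => rfl⟩
  smul_mem' := fun c f hf => ⟨by
    have h := HasCompactSupport.smul_left (f := fun _ : G => c) hf.1
    exact h, fun g u hu => by simp only [Pi.smul_apply, hf.2 g u hu]⟩

/-- A `k`-linear endomorphism `T` of `C = C_c^∞(G,k)` commutes with the left translation
action `(g ·ℓ f)(x) = f(g⁻¹x)`. -/
def CommutesLeft {k G : Type*} [Field k] [Group G] [TopologicalSpace G]
    (T : Module.End k (SmoothCc k G)) : Prop :=
  ∀ (g : G) (f h : SmoothCc k G), (∀ x : G, (h : G → k) x = (f : G → k) (g⁻¹ * x)) →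
    ∀ x : G, (T h : G → k) x = (T f : G → k) (g⁻¹ * x)

open Classical in
/-- Right translation `f ↦ f(· g)` on `C_c^∞(G,k)`. -/
noncomputable def rightTrans (k : Type*) {G : Type*} [Field k] [Group G] [TopologicalSpace G]
    [IsTopologicalGroup G] (g : G) : Module.End k (SmoothCc k G) where
  toFun f := ⟨fun x => (f : G → k) (x * g),
    f.2.1.comp_continuous (continuous_mul_const g),
    f.2.2.comp_homeomorph (Homeomorph.mulRight g)⟩
  map_add' _ _ := rfl
  map_smul' _ _ := rfl

theorem finite_mk_image {G : Type*} [Group G] [TopologicalSpace G] [IsTopologicalGroup G]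
    (U : Subgroup G) (hU : IsOpen (U : Set G)) {K : Set G} (hK : IsCompact K) :
    ((QuotientGroup.mk : G → G ⧸ U) '' K).Finite := by
  have := QuotientGroup.discreteTopology hU
  exact isCompact_iff_finite.1 (hK.image QuotientGroup.continuous_mk)

open Classical in
/-- The indicator function of a coset of `U`. -/
noncomputable def cosetInd (k : Type*) {G : Type*} [Field k] [Group G] [TopologicalSpace G]
    [IsTopologicalGroup G] (U : Subgroup G) (hc : IsCompact (U : Set G))
    (ho : IsOpen (U : Set G)) (q : G ⧸ U) : RightInvCc k G U :=
  ⟨fun x => if (x : G ⧸ U) = q then 1 else 0, by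
    constructor
    · refine HasCompactSupport.of_support_subset_isCompact
        (hc.image (continuous_const_mul q.out)) ?_
      · intro x hx
        have hx' : (x : G ⧸ U) = q := by
          by_contra h
          simp [h] at hx
        refine ⟨q.out⁻¹ * x, ?_, by simp⟩
        apply QuotientGroup.eq.1
        rw [hx', QuotientGroup.out_eq']
    · intro g u hu
      simp [QuotientGroup.mk_mul_of_mem g hu]⟩

/-- Let `G` be a locally profinite group, `k` a field, `U₁, U₂` compact
open subgroups.  Every `k`-linear `G`-equivariant map `ρ : C_c(G/U₁,k) → C_c(G/U₂,k)`
(equivariant for left translation) is the restriction of a `k`-linear endomorphism of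
`C_c^∞(G,k)` commuting with all left translations. -/
theorem stmt_15 (k G : Type*) [Field k] [Group G] [TopologicalSpace G] [IsTopologicalGroup G]
    [LocallyCompactSpace G] [T2Space G] [TotallyDisconnectedSpace G]
    (U₁ U₂ : Subgroup G)
    (hU₁c : IsCompact (U₁ : Set G)) (hU₁o : IsOpen (U₁ : Set G))
    (hU₂c : IsCompact (U₂ : Set G)) (hU₂o : IsOpen (U₂ : Set G))
    (ρ : RightInvCc k G U₁ →ₗ[k] RightInvCc k G U₂)
    (hρ : ∀ (g : G) (f h : RightInvCc k G U₁),
      (∀ x : G, (h : G → k) x = (f : G → k) (g⁻¹ * x)) →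
      ∀ x : G, (ρ h : G → k) x = (ρ f : G → k) (g⁻¹ * x)) :
    ∃ T : Module.End k (SmoothCc k G), CommutesLeft T ∧
      ∀ (f : RightInvCc k G U₁) (f' : SmoothCc k G),
        (f' : G → k) = (f : G → k) → (T f' : G → k) = (ρ f : G → k) := by
  classical
  set δ := cosetInd k U₁ hU₁c hU₁o with hδ
  have δa : ∀ q x, (δ q : G → k) x = if (x : G ⧸ U₁) = q then 1 else 0 := fun _ _ => rfl
  set φ : G → k := (ρ (δ ((1 : G) : G ⧸ U₁)) : G → k) with hφ
  have hφc : HasCompactSupport φ := (ρ (δ ((1 : G) : G ⧸ U₁))).2.1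
  -- translates of the indicator
  have hδt : ∀ g y : G, (ρ (δ (g : G ⧸ U₁)) : G → k) y = φ (g⁻¹ * y) := by
    intro g y
    refine hρ g (δ ((1 : G) : G ⧸ U₁)) (δ (g : G ⧸ U₁)) (fun x => ?_) y
    rw [δa, δa]
    have : ((x : G ⧸ U₁) = g) ↔ (((g⁻¹ * x : G) : G ⧸ U₁) = ((1 : G) : G ⧸ U₁)) := by
      rw [eq_comm, QuotientGroup.eq, eq_comm (b := ((1 : G) : G ⧸ U₁)), QuotientGroup.eq]
      simp
    simp only [this]
  -- the lifted function
  let Ψ : G ⧸ U₁ → k := fun q => φ (q.out⁻¹)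
  have hΨ : ∀ g : G, Ψ (g : G ⧸ U₁) = φ g⁻¹ := by
    intro g
    have h1 := hδt g 1
    have h2 := hδt ((g : G ⧸ U₁).out) 1
    rw [QuotientGroup.out_eq', h1] at h2
    simpa [Ψ] using h2.symm
  have hΨf : (Function.support Ψ).Finite := by
    refine (finite_mk_image U₁ hU₁o hφc.isCompact.inv).subset ?_
    intro q hq
    exact ⟨q.out, subset_tsupport _ hq, QuotientGroup.out_eq' q⟩
  refine ⟨∑ q ∈ hΨf.toFinset, Ψ q • rightTrans k q.out, ?_, ?_⟩
  · intro g f h hfh x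
    have ev : ∀ (f : SmoothCc k G) (x : G),
        (((∑ q ∈ hΨf.toFinset, Ψ q • rightTrans k q.out : Module.End k (SmoothCc k G)) f :
          SmoothCc k G) : G → k) x = ∑ q ∈ hΨf.toFinset, Ψ q * (f : G → k) (x * q.out) := by
      intro f x
      simp [LinearMap.sum_apply, Finset.sum_apply, rightTrans]
    rw [ev, ev]
    simp only [hfh, mul_assoc]
  · intro f f' hff
    funext y
    have ev : (((∑ q ∈ hΨf.toFinset, Ψ q • rightTrans k q.out : Module.End k (SmoothCc k G)) f' :
          SmoothCc k G) : G → k) y = ∑ q ∈ hΨf.toFinset, Ψ q * (f' : G → k) (y * q.out) := by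
      simp [LinearMap.sum_apply, Finset.sum_apply, rightTrans]
    rw [ev, hff]
    let F : G ⧸ U₁ → k := fun q => (f : G → k) q.out
    have hF : ∀ g : G, F (g : G ⧸ U₁) = (f : G → k) g := by
      intro g
      obtain ⟨u, hu⟩ := QuotientGroup.mk_out_eq_mul U₁ g
      simp only [F]
      rw [hu, f.2.2 g u u.2]
    have hFf : (Function.support F).Finite := by
      refine (finite_mk_image U₁ hU₁o f.2.1.isCompact).subset ?_
      intro q hq
      exact ⟨q.out, subset_tsupport _ hq, QuotientGroup.out_eq' q⟩
    have hfs : f = ∑ q ∈ hFf.toFinset, F q • δ q := by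
      ext x
      simp only [AddSubmonoidClass.coe_finsetSum, Submodule.coe_smul, Finset.sum_apply,
        Pi.smul_apply, smul_eq_mul, δa, mul_ite, mul_one, mul_zero]
      rw [Finset.sum_ite_eq, hF]
      split_ifs with h
      · rfl
      · simpa [hF] using h
    have hR : (ρ f : G → k) y = ∑ q ∈ hFf.toFinset, F q * Ψ (y⁻¹ • q) := by
      conv_lhs => rw [hfs]
      simp only [map_sum, map_smul, AddSubmonoidClass.coe_finsetSum, Submodule.coe_smul,
        Finset.sum_apply, Pi.smul_apply, smul_eq_mul]
      refine Finset.sum_congr rfl fun q _ => ?_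
      induction q using QuotientGroup.induction_on with
      | H g =>
        rw [hδt, MulAction.Quotient.smul_coe, smul_eq_mul, hΨ]
        simp
    have hL : ∑ q ∈ hΨf.toFinset, Ψ q * (f : G → k) (y * q.out) =
        ∑ q ∈ hΨf.toFinset, Ψ q * F (y • q) := by
      refine Finset.sum_congr rfl fun q _ => ?_
      rw [← hF, ← smul_eq_mul y, ← MulAction.Quotient.smul_coe, QuotientGroup.out_eq']
    rw [hR, hL, ← finsum_eq_sum_of_support_subset (fun q => F q * Ψ (y⁻¹ • q)),
      ← finsum_eq_sum_of_support_subset (fun q => Ψ q * F (y • q))]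
    · refine finsum_eq_of_bijective (fun q => y • q) (MulAction.bijective y) fun q => ?_
      simp [mul_comm]
    · intro q hq
      simp only [Set.Finite.coe_toFinset]
      exact left_ne_zero_of_mul hq
    · intro q hq
      simp only [Set.Finite.coe_toFinset]
      exact left_ne_zero_of_mul hq
end

section
/- Let p be a prime, let k be a field of characteristic p, and let G be a locally profinite group that contains an open pro-p subgroup and contains no proper open centralisers (i.e. every element of G whose centraliser is open in G lies in the center Z(G)). Let B be the k-algebra of k-linear endomorphisms of C_c^∞(G,k) that commute with both the left translation action (g ·_ℓ f)(x) = f(g⁻¹x) and the right translation action (g ·_r f)(x) = f(xg) of G. Let k̂[Z(G)] be the k-algebra of compatible families (x_{Z'})_{Z'} ∈ Π_{Z'} k[Z(G)/Z'], the product ranging over all compact open subgroups Z' of Z(G), where compatibility means that for compact open subgroups Z'' ⊆ Z' of Z(G) the map k[Z(G)/Z''] → k[Z(G)/Z'] induced by the quotient homomorphism sends x_{Z''} to x_{Z'}. Then B and k̂[Z(G)] are isomorphic as k-algebras. -/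
/-- A `k`-linear endomorphism `T` of `C_c^∞(G,k)` commutes with the right translation
action `(g ·r f)(x) = f(xg)` of `G`. -/
def CommutesRight {k G : Type*} [Field k] [Group G] [TopologicalSpace G]
    (T : Module.End k (SmoothCc k G)) : Prop :=
  ∀ (g : G) (f h : SmoothCc k G), (∀ x : G, (h : G → k) x = (f : G → k) (x * g)) →
    ∀ x : G, (T h : G → k) x = (T f : G → k) (x * g)

/-- The completion `k̂[Z] = lim_{Z'} k[Z/Z']` of the group algebra of a locally profinite
abelian group `Z`, realised as the `k`-subalgebra of compatible families inside the
product of the group algebras `k[Z/Z']` over all compact open subgroups `Z'` of `Z`. -/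
noncomputable def hatGroupAlgebra (k Z : Type*) [Field k] [CommGroup Z]
    [TopologicalSpace Z] :
    Subalgebra k (Π H : {H : Subgroup Z // IsCompact (H : Set Z) ∧ IsOpen (H : Set Z)},
      MonoidAlgebra k (Z ⧸ H.1)) where
  carrier := {x | ∀ (i j : {H : Subgroup Z // IsCompact (H : Set Z) ∧ IsOpen (H : Set Z)})
    (hij : i.1 ≤ j.1),
    MonoidAlgebra.mapDomainAlgHom k k
      (QuotientGroup.map i.1 j.1 (MonoidHom.id Z) (by simpa using hij)) (x i) = x j}
  mul_mem' := fun hx hy i j hij => by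
    simp only [Pi.mul_apply, map_mul, hx i j hij, hy i j hij]
  add_mem' := fun hx hy i j hij => by
    simp only [Pi.add_apply, map_add, hx i j hij, hy i j hij]
  algebraMap_mem' := fun r i j hij => by
    simp only [Pi.algebraMap_apply, AlgHom.commutes]

open scoped IsMulCommutative

namespace BC

/-- Fixed point counting in a finite `p`-group acting on itself by two-sided multiplication. -/
theorem exists_fixed {p : ℕ} (hp : p.Prime) {k Q : Type*} [Field k] [CharP k p] [Group Q]
    [Fintype Q] (hQ : IsPGroup p Q) (φ : Q → k) (hs : ∑ q, φ q ≠ 0) :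
    ∃ q : Q, ∀ a b : Q, (∀ q', φ (a * q' * b⁻¹) = φ q') → a * q * b⁻¹ = q := by
  classical
  have : Fact p.Prime := ⟨hp⟩
  let P : Subgroup (Q × Q) :=
    { carrier := {ab | ∀ q', φ (ab.1 * q' * ab.2⁻¹) = φ q'}
      mul_mem' := by
        intro x y hx hy q
        have h1 := hx (y.1 * q * y.2⁻¹)
        have h2 := hy q
        rw [← h2, ← h1]
        simp [mul_assoc]
      one_mem' := by intro q; simp
      inv_mem' := by
        intro x hx q
        have h1 := hx (x.1⁻¹ * q * x.2⁻¹⁻¹)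
        simp only [Prod.fst_inv, Prod.snd_inv]
        rw [← h1]
        simp [mul_assoc] }
  have hP : IsPGroup p P := by
    apply IsPGroup.to_subgroup
    intro g
    obtain ⟨m, hm⟩ := hQ g.1
    obtain ⟨n, hn⟩ := hQ g.2
    refine ⟨m + n, ?_⟩
    ext
    · simp [pow_add, pow_mul, hm]
    · simp [pow_add, mul_comm (p ^ m), pow_mul, hn]
  by_contra hcon
  push Not at hcon
  apply hs
  have key : ∀ c : k, ((Finset.univ.filter (fun q => φ q = c)).card : k) = 0 := by
    intro c
    let X := {q : Q // φ q = c}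
    let _ : MulAction P X :=
      { smul := fun g q => ⟨g.1.1 * q.1 * g.1.2⁻¹, by rw [g.2 q.1]; exact q.2⟩
        one_smul := by
          intro q
          apply Subtype.ext
          change (1 : Q) * q.1 * (1 : Q)⁻¹ = q.1
          simp
        mul_smul := by
          intro g h q
          apply Subtype.ext
          change (g.1.1 * h.1.1) * q.1 * (g.1.2 * h.1.2)⁻¹
            = g.1.1 * (h.1.1 * q.1 * h.1.2⁻¹) * g.1.2⁻¹
          simp [mul_assoc] }
    have h1 := hP.card_modEq_card_fixedPoints X
    have h2 : IsEmpty (MulAction.fixedPoints P X) := by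
      constructor
      rintro ⟨q, hq⟩
      obtain ⟨a, b, hab, hne⟩ := hcon q.1
      apply hne
      have := hq ⟨(a, b), hab⟩
      exact congrArg Subtype.val this
    rw [Nat.card_of_isEmpty (α := MulAction.fixedPoints P X), Nat.modEq_zero_iff_dvd, ← CharP.cast_eq_zero_iff k p] at h1
    rw [← h1, Nat.card_eq_fintype_card, Fintype.card_subtype]
  have := Finset.sum_fiberwise_of_maps_to (s := (Finset.univ : Finset Q))
    (t := Finset.univ.image φ) (g := φ) (by intro x hx; simp) φ
  rw [← this]
  apply Finset.sum_eq_zero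
  intro c _
  rw [Finset.sum_congr rfl (g := fun _ => c) (by intro x hx; simpa using hx)]
  rw [Finset.sum_const, nsmul_eq_mul, key, zero_mul]

section Abstract

variable {k Z M : Type*} [Field k] [CommGroup Z] [AddCommGroup M] [Module k M]

/-- projection `k[Z] → k[Z/H]` -/
noncomputable abbrev prj (k : Type*) [Field k] (H : Subgroup Z) :
    MonoidAlgebra k Z →ₐ[k] MonoidAlgebra k (Z ⧸ H) :=
  MonoidAlgebra.mapDomainAlgHom k k (QuotientGroup.mk' H)

theorem prj_surj (H : Subgroup Z) : Function.Surjective (prj k H) := by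
  intro x
  induction x using MonoidAlgebra.induction_on with
  | of q =>
    obtain ⟨z, rfl⟩ := QuotientGroup.mk_surjective q
    exact ⟨MonoidAlgebra.single z 1, by simp [prj]⟩
  | add x y hx hy =>
    obtain ⟨a, rfl⟩ := hx
    obtain ⟨b, rfl⟩ := hy
    exact ⟨a + b, map_add _ _ _⟩
  | smul r x hx =>
    obtain ⟨a, rfl⟩ := hx
    exact ⟨r • a, map_smul _ _ _⟩

theorem map_prj (H K : Subgroup Z) (h : H ≤ K.comap (MonoidHom.id Z)) (a : MonoidAlgebra k Z) :
    MonoidAlgebra.mapDomainAlgHom k k (QuotientGroup.map H K (MonoidHom.id Z) h) (prj k H a)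
      = prj k K a := by
  induction a using MonoidAlgebra.induction_on with
  | of z => simp [prj]
  | add x y hx hy => rw [map_add, map_add, map_add, hx, hy]
  | smul r x hx => rw [map_smul, map_smul, map_smul, hx]

/-- action of the group algebra -/
noncomputable abbrev act (ρ : Z →* Module.End k M) : MonoidAlgebra k Z →ₐ[k] Module.End k M :=
  MonoidAlgebra.lift k (Module.End k M) Z ρ

theorem act_eq (ρ : Z →* Module.End k M) (H : Subgroup Z) (m : M) (hm : ∀ h ∈ H, ρ h m = m)
    (a : MonoidAlgebra k Z) :
    act ρ a m = Finsupp.linearCombination k (fun q : Z ⧸ H => ρ q.out m) (prj k H a).coeff := by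
  induction a using MonoidAlgebra.induction_on with
  | of z =>
    have : ρ (Quotient.out (z : Z ⧸ H)) m = ρ z m := by
      obtain ⟨h, hh⟩ := QuotientGroup.mk_out_eq_mul H z
      rw [hh, map_mul, Module.End.mul_apply, hm h.1 h.2]
    simp [prj, this]
  | add x y hx hy => rw [map_add, map_add, LinearMap.add_apply, hx, hy]; simp
  | smul r x hx => rw [map_smul, map_smul, LinearMap.smul_apply, hx]; simp

theorem act_congr (ρ : Z →* Module.End k M) (H : Subgroup Z) (m : M) (hm : ∀ h ∈ H, ρ h m = m)
    (a b : MonoidAlgebra k Z) (hab : prj k H a = prj k H b) : act ρ a m = act ρ b m := by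
  rw [act_eq ρ H m hm, act_eq ρ H m hm, hab]

theorem act_fixed (ρ : Z →* Module.End k M) (z : Z) (m : M) (hm : ρ z m = m)
    (a : MonoidAlgebra k Z) : ρ z (act ρ a m) = act ρ a m := by
  induction a using MonoidAlgebra.induction_on with
  | of w =>
    simp only [act, MonoidAlgebra.lift_of]
    rw [← Module.End.mul_apply, ← map_mul, mul_comm, map_mul, Module.End.mul_apply, hm]
  | add x y hx hy => rw [map_add, LinearMap.add_apply, map_add, hx, hy]
  | smul r x hx => rw [map_smul, LinearMap.smul_apply, map_smul, hx]

variable [TopologicalSpace Z] [IsTopologicalGroup Z]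

theorem exists_Phi (ρ : Z →* Module.End k M)
    (hsm : ∀ m, ∃ H : Subgroup Z, (IsCompact (H : Set Z) ∧ IsOpen (H : Set Z)) ∧
      ∀ h ∈ H, ρ h m = m) :
    ∃ Φ : hatGroupAlgebra k Z →ₐ[k] Module.End k M,
      ∀ (x : hatGroupAlgebra k Z)
        (H : {H : Subgroup Z // IsCompact (H : Set Z) ∧ IsOpen (H : Set Z)}) (m : M),
        (∀ h ∈ H.1, ρ h m = m) → ∀ a, prj k H.1 a = x.1 H → Φ x m = act ρ a m := by
  classical
  have hinf : ∀ H K : Subgroup Z, (IsCompact (H : Set Z) ∧ IsOpen (H : Set Z)) →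
      (IsCompact (K : Set Z) ∧ IsOpen (K : Set Z)) →
      (IsCompact ((H ⊓ K : Subgroup Z) : Set Z) ∧ IsOpen ((H ⊓ K : Subgroup Z) : Set Z)) := by
    intro H K hH hK
    rw [Subgroup.coe_inf]
    exact ⟨hH.1.inter_right (Subgroup.isClosed_of_isOpen _ hK.2), hH.2.inter hK.2⟩
  choose N hN hfix using hsm
  let L : ∀ x : hatGroupAlgebra k Z, ∀ m, MonoidAlgebra k Z := fun x m =>
    (prj_surj (N m) (x.1 ⟨N m, hN m⟩)).choose
  have hL : ∀ x m, prj k (N m) (L x m) = x.1 ⟨N m, hN m⟩ := fun x m =>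
    (prj_surj (N m) (x.1 ⟨N m, hN m⟩)).choose_spec
  have key : ∀ (x : hatGroupAlgebra k Z)
        (H : {H : Subgroup Z // IsCompact (H : Set Z) ∧ IsOpen (H : Set Z)}) (m : M),
        (∀ h ∈ H.1, ρ h m = m) → ∀ a, prj k H.1 a = x.1 H → act ρ (L x m) m = act ρ a m := by
    intro x H m hm a ha
    let K : {H : Subgroup Z // IsCompact (H : Set Z) ∧ IsOpen (H : Set Z)} :=
      ⟨H.1 ⊓ N m, hinf _ _ H.2 (hN m)⟩
    obtain ⟨c, hc⟩ := prj_surj K.1 (x.1 K)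
    have h1 : prj k H.1 c = x.1 H := by
      rw [← x.2 K H inf_le_left, ← hc, map_prj]
    have h2 : prj k (N m) c = x.1 ⟨N m, hN m⟩ := by
      rw [← x.2 K ⟨N m, hN m⟩ inf_le_right, ← hc, map_prj]
    rw [act_congr ρ (N m) m (hfix m) (L x m) c (by rw [hL, h2]),
      act_congr ρ H.1 m hm a c (by rw [ha, h1])]
  let Φ0 : hatGroupAlgebra k Z → Module.End k M := fun x =>
    { toFun := fun m => act ρ (L x m) m
      map_add' := by
        intro m n
        let K : {H : Subgroup Z // IsCompact (H : Set Z) ∧ IsOpen (H : Set Z)} :=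
          ⟨N m ⊓ N n, hinf _ _ (hN m) (hN n)⟩
        obtain ⟨c, hc⟩ := prj_surj K.1 (x.1 K)
        rw [key x K m (fun h hh => hfix m h hh.1) c hc,
          key x K n (fun h hh => hfix n h hh.2) c hc,
          key x K (m + n) (fun h hh => by
            rw [map_add, hfix m h hh.1, hfix n h hh.2]) c hc, map_add]
      map_smul' := by
        intro r m
        rw [key x ⟨N m, hN m⟩ (r • m) (fun h hh => by rw [map_smul, hfix m h hh]) _ (hL x m),
          map_smul]
        rfl }
  have hΦ0 : ∀ x m, Φ0 x m = act ρ (L x m) m := fun x m => rfl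
  have key2 : ∀ (x : hatGroupAlgebra k Z)
        (H : {H : Subgroup Z // IsCompact (H : Set Z) ∧ IsOpen (H : Set Z)}) (m : M),
        (∀ h ∈ H.1, ρ h m = m) → ∀ a, prj k H.1 a = x.1 H → Φ0 x m = act ρ a m := key
  refine ⟨AlgHom.ofLinearMap
    { toFun := Φ0
      map_add' := ?_
      map_smul' := ?_ } ?_ ?_, key2⟩
  · intro x y
    ext m
    rw [key2 (x + y) ⟨N m, hN m⟩ m (hfix m) (L x m + L y m) (by rw [map_add, hL, hL]; rfl),
      map_add]
    rfl
  · intro r x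
    ext m
    rw [key2 (r • x) ⟨N m, hN m⟩ m (hfix m) (r • L x m) (by rw [map_smul, hL]; rfl), map_smul]
    rfl
  · ext m
    change Φ0 1 m = m
    rw [key2 1 ⟨N m, hN m⟩ m (hfix m) 1 (by rw [map_one]; rfl), map_one]
    rfl
  · intro x y
    ext m
    change Φ0 (x * y) m = Φ0 x (Φ0 y m)
    rw [key2 (x * y) ⟨N m, hN m⟩ m (hfix m) (L x m * L y m) (by rw [map_mul, hL, hL]; rfl),
      map_mul, hΦ0 y, Module.End.mul_apply,
      key2 x ⟨N m, hN m⟩ (act ρ (L y m) m)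
        (fun h hh => act_fixed ρ h m (hfix m h hh) _) (L x m) (hL x m)]

end Abstract

section Trans

variable {k G : Type*} [Field k] [Group G] [TopologicalSpace G] [IsTopologicalGroup G]

/-- left translation -/
def ltr (k G : Type*) [Field k] [Group G] [TopologicalSpace G] [IsTopologicalGroup G] :
    G →* Module.End k (SmoothCc k G) where
  toFun g :=
    { toFun := fun f => ⟨fun x => f.1 (g⁻¹ * x),
        f.2.1.comp_continuous (continuous_const_mul g⁻¹),
        f.2.2.comp_homeomorph (Homeomorph.mulLeft g⁻¹)⟩
      map_add' := fun f h => rfl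
      map_smul' := fun c f => rfl }
  map_one' := by
    ext f x
    simp
  map_mul' g h := by
    ext f x
    simp [mul_assoc]

/-- right translation -/
def rtr (g : G) (f : SmoothCc k G) : SmoothCc k G :=
  ⟨fun x => f.1 (x * g), f.2.1.comp_continuous (continuous_mul_const g),
        f.2.2.comp_homeomorph (Homeomorph.mulRight g)⟩

theorem ltr_apply (g : G) (f : SmoothCc k G) (x : G) : (ltr k G g f).1 x = f.1 (g⁻¹ * x) := rfl

theorem rtr_apply (g : G) (f : SmoothCc k G) (x : G) : (rtr g f).1 x = f.1 (x * g) := rfl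

theorem comm_ltr {T : Module.End k (SmoothCc k G)} (hT : CommutesLeft T) (g : G)
    (f : SmoothCc k G) : T (ltr k G g f) = ltr k G g (T f) := by
  apply Subtype.ext
  funext x
  exact hT g f (ltr k G g f) (fun _ => rfl) x

theorem comm_rtr {T : Module.End k (SmoothCc k G)} (hT : CommutesRight T) (g : G)
    (f : SmoothCc k G) : T (rtr g f) = rtr g (T f) := by
  apply Subtype.ext
  funext x
  exact hT g f (rtr g f) (fun _ => rfl) x

open Classical in
/-- indicator function of a compact open set -/
noncomputable def ind (k : Type*) [Field k] [T2Space G] (S : Set G) (hc : IsCompact S)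
    (ho : IsOpen S) : SmoothCc k G :=
  ⟨fun x => if x ∈ S then 1 else 0, by
    constructor
    · rw [IsLocallyConstant.iff_exists_open]
      intro x
      by_cases hx : x ∈ S
      · exact ⟨S, ho, hx, fun y hy => by simp [hx, hy]⟩
      · exact ⟨Sᶜ, hc.isClosed.isOpen_compl, hx, fun y hy => by
          have hy' : y ∉ S := hy
          simp [hx, hy']⟩
    · apply HasCompactSupport.intro hc
      intro x hx
      simp [hx]⟩

open Classical in
theorem ind_apply [T2Space G] (S : Set G) (hc : IsCompact S)
    (ho : IsOpen S) (x : G) : (ind k S hc ho).1 x = if x ∈ S then 1 else 0 := rfl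

theorem decomp [T2Space G] (V : Subgroup G) (hc : IsCompact (V : Set G))
    (ho : IsOpen (V : Set G)) (f : SmoothCc k G) (hf : ∀ x, ∀ v ∈ V, f.1 (x * v) = f.1 x) :
    ∃ S : Finset (G ⧸ V), f = ∑ q ∈ S, f.1 q.out • ltr k G q.out (ind k V hc ho) := by
  classical
  have hd : DiscreteTopology (G ⧸ V) := QuotientGroup.discreteTopology ho
  have hcomp : IsCompact ((QuotientGroup.mk : G → G ⧸ V) '' tsupport f.1) :=
    IsCompact.image (f.2.2) QuotientGroup.continuous_mk
  have hfin := hcomp.finite_of_discrete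
  refine ⟨hfin.toFinset, ?_⟩
  apply Subtype.ext
  funext x
  have hout : f.1 (Quotient.out (x : G ⧸ V)) = f.1 x := by
    obtain ⟨h, hh⟩ := QuotientGroup.mk_out_eq_mul V x
    rw [hh, hf _ _ h.2]
  have hev : (∑ q ∈ hfin.toFinset, f.1 q.out • ltr k G q.out (ind k V hc ho)).1 x
      = ∑ q ∈ hfin.toFinset, if q = (x : G ⧸ V) then f.1 q.out else 0 := by
    rw [Submodule.coe_sum, Finset.sum_apply]
    apply Finset.sum_congr rfl
    intro q _
    have : (q.out⁻¹ * x ∈ (V : Set G)) ↔ q = (x : G ⧸ V) := by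
      rw [SetLike.mem_coe, ← QuotientGroup.eq, QuotientGroup.out_eq']
    change f.1 q.out * (ind k V hc ho).1 (q.out⁻¹ * x) = _
    rw [ind_apply, if_congr this rfl rfl]
    simp
  rw [hev, Finset.sum_ite_eq']
  split_ifs with h
  · exact hout.symm
  · by_contra hne
    apply h
    rw [Set.Finite.mem_toFinset]
    exact ⟨x, subset_tsupport _ hne, rfl⟩

/-- open subgroups of `U₀` normalised by `U₀` -/
def Good (U₀ V : Subgroup G) : Prop :=
  V ≤ U₀ ∧ IsOpen (V : Set G) ∧ ∀ u ∈ U₀, ∀ v ∈ V, u * v * u⁻¹ ∈ V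

theorem Good.compact {U₀ V : Subgroup G} (h : Good U₀ V) (hU : IsCompact (U₀ : Set G)) :
    IsCompact (V : Set G) :=
  hU.of_isClosed_subset (Subgroup.isClosed_of_isOpen _ h.2.1) h.1

theorem Good.inf {U₀ V W : Subgroup G} (h : Good U₀ V) (h' : Good U₀ W) : Good U₀ (V ⊓ W) :=
  ⟨inf_le_left.trans h.1, by rw [Subgroup.coe_inf]; exact h.2.1.inter h'.2.1,
    fun u hu v hv => ⟨h.2.2 u hu v hv.1, h'.2.2 u hu v hv.2⟩⟩

theorem good_basis [T2Space G] [TotallyDisconnectedSpace G] (U₀ : Subgroup G)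
    (hc : IsCompact (U₀ : Set G)) (ho : IsOpen (U₀ : Set G)) (S : Set G) (hS : S ∈ nhds (1 : G)) :
    ∃ V, Good U₀ V ∧ (V : Set G) ⊆ S := by
  have : CompactSpace U₀ := isCompact_iff_compactSpace.mp hc
  obtain ⟨S', hS', hSo, hS1⟩ := mem_nhds_iff.mp hS
  obtain ⟨N, hN⟩ := ProfiniteGrp.exist_openNormalSubgroup_sub_open_nhds_of_one (G := U₀)
    (U := Subtype.val ⁻¹' S') (hSo.preimage continuous_subtype_val) (by simpa using hS1)
  refine ⟨N.toSubgroup.map U₀.subtype, ⟨?_, ?_, ?_⟩, ?_⟩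
  · exact Subgroup.map_subtype_le _
  · rw [Subgroup.coe_map]
    exact ho.isOpenMap_subtype_val _ N.isOpen'
  · rintro u hu _ ⟨v, hv, rfl⟩
    exact ⟨⟨u, hu⟩ * v * ⟨u, hu⟩⁻¹, N.isNormal'.conj_mem v hv _, rfl⟩
  · rintro _ ⟨v, hv, rfl⟩
    exact hS' (hN hv)

theorem exists_good_inv [T2Space G] [TotallyDisconnectedSpace G] (U₀ : Subgroup G)
    (hc : IsCompact (U₀ : Set G)) (ho : IsOpen (U₀ : Set G)) (f : SmoothCc k G) :
    ∃ V, Good U₀ V ∧ ∀ x, ∀ v ∈ V, f.1 (x * v) = f.1 x := by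
  let N : Set (G × G) := {xv | f.1 (xv.1 * xv.2) = f.1 xv.1}
  have hN : IsOpen N := by
    rw [isOpen_iff_mem_nhds]
    rintro ⟨x, v⟩ hxv
    have h1 := (f.2.1.comp_continuous (continuous_mul (M := G))).eventually_eq (x, v)
    have h2 := (f.2.1.comp_continuous (continuous_fst (X := G) (Y := G))).eventually_eq (x, v)
    filter_upwards [h1, h2] with y hy1 hy2
    exact (hy1.trans hxv).trans hy2.symm
  obtain ⟨A, B, hA, hB, hKA, h1B, hAB⟩ := generalized_tube_lemma (s := tsupport f.1)
    f.2.2 (t := {1}) isCompact_singleton (n := N) hN (by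
      rintro ⟨x, v⟩ ⟨hx, hv⟩
      have hv' : v = 1 := hv
      subst hv'
      simp [N])
  obtain ⟨V, hV, hVB⟩ := good_basis U₀ hc ho B (hB.mem_nhds (h1B rfl))
  refine ⟨V, hV, fun x v hv => ?_⟩
  by_cases hx : x ∈ tsupport f.1
  · exact hAB (Set.mk_mem_prod (hKA hx) (hVB hv))
  · by_cases hxv : x * v ∈ tsupport f.1
    · have : f.1 (x * v * v⁻¹) = f.1 (x * v) :=
        hAB (Set.mk_mem_prod (hKA hxv) (hVB (V.inv_mem hv)))
      rw [← this, mul_inv_cancel_right]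
    · rw [image_eq_zero_of_notMem_tsupport hx, image_eq_zero_of_notMem_tsupport hxv]

end Trans

section Support

variable {k G : Type*} [Field k] [Group G] [TopologicalSpace G] [IsTopologicalGroup G]
  [T2Space G]

theorem ind_left (V : Subgroup G) (hc : IsCompact (V : Set G)) (ho : IsOpen (V : Set G))
    (g h : G) (hgh : g⁻¹ * h ∈ V) : ltr k G g (ind k V hc ho) = ltr k G h (ind k V hc ho) := by
  classical
  apply Subtype.ext
  funext x
  rw [ltr_apply, ltr_apply, ind_apply, ind_apply]
  apply if_congr _ rfl rfl
  have : g⁻¹ * x = (g⁻¹ * h) * (h⁻¹ * x) := by group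
  rw [this, SetLike.mem_coe, Subgroup.mul_mem_cancel_left _ hgh]
  rfl

theorem T_left (V : Subgroup G) (hc : IsCompact (V : Set G)) (ho : IsOpen (V : Set G))
    {T : Module.End k (SmoothCc k G)} (hT : CommutesLeft T) (v : G) (hv : v ∈ V) (x : G) :
    (T (ind k V hc ho)).1 (v * x) = (T (ind k V hc ho)).1 x := by
  have h1 := ind_left (k := k) V hc ho v⁻¹ 1 (by simpa using hv)
  have h2 := comm_ltr hT v⁻¹ (ind k V hc ho)
  rw [h1, map_one, Module.End.one_apply] at h2
  have h3 := congrArg (fun f => f.1 x) h2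
  simp only [ltr_apply, inv_inv] at h3
  exact h3.symm

theorem T_right (V : Subgroup G) (hc : IsCompact (V : Set G)) (ho : IsOpen (V : Set G))
    {T : Module.End k (SmoothCc k G)} (hT : CommutesRight T) (v : G) (hv : v ∈ V) (x : G) :
    (T (ind k V hc ho)).1 (x * v) = (T (ind k V hc ho)).1 x := by
  classical
  have h1 : rtr v (ind k V hc ho) = ind k V hc ho := by
    apply Subtype.ext
    funext y
    rw [rtr_apply, ind_apply, ind_apply]
    apply if_congr _ rfl rfl
    rw [SetLike.mem_coe, Subgroup.mul_mem_cancel_right _ hv]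
    rfl
  have h2 := comm_rtr hT v (ind k V hc ho)
  rw [h1] at h2
  exact (congrArg (fun f => f.1 x) h2).symm

theorem T_conj (V : Subgroup G) (hc : IsCompact (V : Set G)) (ho : IsOpen (V : Set G))
    {T : Module.End k (SmoothCc k G)} (hT : CommutesLeft T) (hT' : CommutesRight T) (w : G)
    (hw : ∀ v, w * v * w⁻¹ ∈ V ↔ v ∈ V) (x : G) :
    (T (ind k V hc ho)).1 (w * x * w⁻¹) = (T (ind k V hc ho)).1 x := by
  classical
  have h1 : rtr w⁻¹ (ltr k G w⁻¹ (ind k V hc ho)) = ind k V hc ho := by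
    apply Subtype.ext
    funext y
    rw [rtr_apply, ltr_apply, ind_apply, ind_apply]
    apply if_congr _ rfl rfl
    rw [SetLike.mem_coe, SetLike.mem_coe, inv_inv, ← mul_assoc, hw]
  have h2 := comm_rtr hT' w⁻¹ (ltr k G w⁻¹ (ind k V hc ho))
  rw [h1, comm_ltr hT] at h2
  have h3 := congrArg (fun f => f.1 x) h2
  simp only [ltr_apply, rtr_apply, inv_inv] at h3
  rw [h3, mul_assoc]

theorem step (p : ℕ) (hp : p.Prime) [CharP k p] (U₀ : Subgroup G) (hc : IsCompact (U₀ : Set G))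
    (hpro : ∀ (V : Subgroup U₀) [V.Normal], IsOpen (V : Set U₀) → IsPGroup p (U₀ ⧸ V))
    {T : Module.End k (SmoothCc k G)} (hT : CommutesLeft T) (hT' : CommutesRight T)
    (U V : Subgroup G) (hU : Good U₀ U) (hV : Good U₀ V) (hVU : V ≤ U) (x : G)
    (hx : (T (ind k U (hU.compact hc) hU.2.1)).1 x ≠ 0) :
    ∃ u ∈ U, ∀ w ∈ U, x * w * x⁻¹ ∈ U → (u⁻¹ * x) * w * (u⁻¹ * x)⁻¹ * w⁻¹ ∈ V := by
  classical
  have hn0 : (V.subgroupOf U₀).Normal := ⟨fun v hv u => hV.2.2 u.1 u.2 v.1 hv⟩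
  have hn : (V.subgroupOf U).Normal := ⟨fun v hv u => hV.2.2 u.1 (hU.1 u.2) v.1 hv⟩
  have hp0 : IsPGroup p (U₀ ⧸ V.subgroupOf U₀) :=
    hpro _ (hV.2.1.preimage continuous_subtype_val)
  have hpQ : IsPGroup p (U ⧸ V.subgroupOf U) := by
    intro q
    obtain ⟨u, rfl⟩ := QuotientGroup.mk_surjective q
    obtain ⟨n, hn⟩ := hp0 (QuotientGroup.mk ⟨u.1, hU.1 u.2⟩)
    refine ⟨n, ?_⟩
    rw [← QuotientGroup.mk_pow, QuotientGroup.eq_one_iff] at hn ⊢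
    exact hn
  have hcU : CompactSpace U := isCompact_iff_compactSpace.mp (hU.compact hc)
  have hfin : Finite (U ⧸ V.subgroupOf U) :=
    Subgroup.quotient_finite_of_isOpen _ (hV.2.1.preimage continuous_subtype_val)
  let _ : Fintype (U ⧸ V.subgroupOf U) := Fintype.ofFinite _
  set iV := ind k (V : Set G) (hV.compact hc) hV.2.1 with hiV
  set iU := ind k (U : Set G) (hU.compact hc) hU.2.1 with hiU
  have hsum : iU = ∑ q : U ⧸ V.subgroupOf U, ltr k G (q.out : U).1 iV := by
    apply Subtype.ext
    funext y
    rw [Submodule.coe_sum, Finset.sum_apply]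
    by_cases hy : y ∈ U
    · rw [hiU, ind_apply, if_pos (show y ∈ (U : Set G) from hy), Finset.sum_eq_single (QuotientGroup.mk (⟨y, hy⟩ : U))]
      · have hm := (QuotientGroup.eq (s := V.subgroupOf U)).mp
          (QuotientGroup.out_eq' (QuotientGroup.mk (⟨y, hy⟩ : U) : U ⧸ V.subgroupOf U))
        rw [ltr_apply, hiV, ind_apply, if_pos]
        exact hm
      · intro q _ hq
        rw [ltr_apply, hiV, ind_apply, if_neg]
        intro hmem
        apply hq
        rw [← QuotientGroup.out_eq' q, QuotientGroup.eq]
        exact hmem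
      · simp
    · rw [hiU, ind_apply, if_neg (show y ∉ (U : Set G) from hy), Finset.sum_eq_zero]
      intro q _
      rw [ltr_apply, hiV, ind_apply, if_neg]
      intro hmem
      apply hy
      have := U.mul_mem (q.out : U).2 (hVU hmem)
      simpa using this
  let φ : U ⧸ V.subgroupOf U → k := fun q => (T iV).1 ((q.out : U).1⁻¹ * x)
  have hφ : ∀ u : U, φ (QuotientGroup.mk u) = (T iV).1 (u.1⁻¹ * x) := by
    intro u
    obtain ⟨v, hv⟩ := QuotientGroup.mk_out_eq_mul (V.subgroupOf U) u
    simp only [φ]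
    rw [hv]
    have hv2 : v.1.1 ∈ V := v.2
    have := T_left V (hV.compact hc) hV.2.1 hT (v.1.1⁻¹) (V.inv_mem hv2) (u.1⁻¹ * x)
    rw [← hiV] at this
    rw [← this]
    simp [mul_assoc]
  have hs : ∑ q, φ q ≠ 0 := by
    have : (T iU).1 x = ∑ q, φ q := by
      rw [hsum, map_sum, Submodule.coe_sum, Finset.sum_apply]
      apply Finset.sum_congr rfl
      intro q _
      rw [comm_ltr hT]
      rfl
    rwa [← this]
  obtain ⟨q, hq⟩ := exists_fixed hp hpQ φ hs
  obtain ⟨u, rfl⟩ := QuotientGroup.mk_surjective q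
  refine ⟨u.1, u.2, fun w hw hxw => ?_⟩
  have h1 := hq (QuotientGroup.mk ⟨x * w * x⁻¹, hxw⟩) (QuotientGroup.mk ⟨w, hw⟩) (by
    intro q'
    obtain ⟨u', rfl⟩ := QuotientGroup.mk_surjective q'
    rw [← QuotientGroup.mk_mul, ← QuotientGroup.mk_inv, ← QuotientGroup.mk_mul, hφ, hφ]
    have hw0 : ∀ v, w * v * w⁻¹ ∈ V ↔ v ∈ V := by
      intro v
      constructor
      · intro h
        have := hV.2.2 w⁻¹ (U₀.inv_mem (hU.1 hw)) _ h
        have e : w⁻¹ * (w * v * w⁻¹) * w⁻¹⁻¹ = v := by group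
        rwa [e] at this
      · exact hV.2.2 w (hU.1 hw) v
    have hcj := T_conj V (hV.compact hc) hV.2.1 hT hT' w hw0 (u'.1⁻¹ * x)
    rw [← hiV] at hcj
    rw [← hcj]
    simp [mul_assoc])
  rw [← QuotientGroup.mk_mul, ← QuotientGroup.mk_inv, ← QuotientGroup.mk_mul] at h1
  have h2 := (QuotientGroup.eq (s := V.subgroupOf U)).mp h1.symm
  have h3 : u.1⁻¹ * (x * w * x⁻¹ * u.1 * w⁻¹) ∈ V := h2
  have e : u.1⁻¹ * x * w * (u.1⁻¹ * x)⁻¹ * w⁻¹ = u.1⁻¹ * (x * w * x⁻¹ * u.1 * w⁻¹) := by group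
  rw [e]
  exact h3

theorem supp [TotallyDisconnectedSpace G] (p : ℕ) (hp : p.Prime) [CharP k p] (U₀ : Subgroup G)
    (hc : IsCompact (U₀ : Set G)) (ho : IsOpen (U₀ : Set G))
    (hpro : ∀ (V : Subgroup U₀) [V.Normal], IsOpen (V : Set U₀) → IsPGroup p (U₀ ⧸ V))
    (hG : ∀ y : G, IsOpen ((Subgroup.centralizer {y} : Subgroup G) : Set G) →
      y ∈ Subgroup.center G)
    {T : Module.End k (SmoothCc k G)} (hT : CommutesLeft T) (hT' : CommutesRight T)
    (U : Subgroup G) (hU : Good U₀ U) (x : G)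
    (hx : (T (ind k U (hU.compact hc) hU.2.1)).1 x ≠ 0) :
    ∃ u ∈ U, u⁻¹ * x ∈ Subgroup.center G := by
  let I := {V : Subgroup G // Good U₀ V ∧ V ≤ U}
  let Y : I → Set G := fun V =>
    {u | u ∈ U ∧ ∀ w ∈ U, x * w * x⁻¹ ∈ U → (u⁻¹ * x) * w * (u⁻¹ * x)⁻¹ * w⁻¹ ∈ V.1}
  have hUcl : IsClosed (U : Set G) := Subgroup.isClosed_of_isOpen _ hU.2.1
  have hcl : ∀ V, IsClosed (Y V) := by
    intro V
    have hV : IsClosed (V.1 : Set G) := Subgroup.isClosed_of_isOpen _ V.2.1.2.1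
    have : Y V = (U : Set G) ∩ ⋂ (w : G) (_ : w ∈ U) (_ : x * w * x⁻¹ ∈ U),
        (fun u : G => (u⁻¹ * x) * w * (u⁻¹ * x)⁻¹ * w⁻¹) ⁻¹' (V.1 : Set G) := by
      ext u
      simp [Y]
    rw [this]
    refine hUcl.inter (isClosed_iInter fun w => isClosed_iInter fun _ => isClosed_iInter fun _ =>
      hV.preimage (by fun_prop))
  have hne : Nonempty I := ⟨⟨U, hU, le_rfl⟩⟩
  have hinter := IsCompact.nonempty_iInter_of_directed_nonempty_isCompact_isClosed Y (by
      intro V W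
      refine ⟨⟨V.1 ⊓ W.1, V.2.1.inf W.2.1, inf_le_left.trans V.2.2⟩, ?_, ?_⟩
      · exact fun u hu => ⟨hu.1, fun w hw hxw => (hu.2 w hw hxw).1⟩
      · exact fun u hu => ⟨hu.1, fun w hw hxw => (hu.2 w hw hxw).2⟩)
    (by
      intro V
      obtain ⟨u, hu, h⟩ := step p hp U₀ hc hpro hT hT' U V.1 hU V.2.1 V.2.2 x hx
      exact ⟨u, hu, h⟩)
    (fun V => (hU.compact hc).of_isClosed_subset (hcl V) fun u hu => hu.1)
    hcl
  obtain ⟨u, hu⟩ := hinter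
  rw [Set.mem_iInter] at hu
  refine ⟨u, (hu ⟨U, hU, le_rfl⟩).1, ?_⟩
  apply hG
  apply Subgroup.isOpen_of_mem_nhds (g := 1)
  have hnh : (U : Set G) ∩ (fun w => x * w * x⁻¹) ⁻¹' (U : Set G) ∈ nhds (1 : G) := by
    apply IsOpen.mem_nhds
    · exact hU.2.1.inter (hU.2.1.preimage (by fun_prop))
    · simp [U.one_mem]
  filter_upwards [hnh]
  rintro w ⟨hw, hxw⟩
  rw [SetLike.mem_coe, Subgroup.mem_centralizer_singleton_iff]
  set y := u⁻¹ * x with hy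
  have key : y * w * y⁻¹ * w⁻¹ = 1 := by
    by_contra hne1
    obtain ⟨V, hV, hVs⟩ := good_basis U₀ hc ho ({y * w * y⁻¹ * w⁻¹}ᶜ)
      (isOpen_compl_singleton.mem_nhds (fun h => hne1 h.symm))
    have := (hu ⟨V ⊓ U, hV.inf hU, inf_le_right⟩).2 w hw hxw
    exact hVs this.1 rfl
  have h2 : y * w = w * y := by
    have := mul_inv_eq_one.mp key
    rw [mul_inv_eq_iff_eq_mul] at this
    exact this
  first | exact h2 | exact h2.symm

end Support

section Final

variable {k G : Type*} [Field k] [Group G] [TopologicalSpace G] [IsTopologicalGroup G]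

/-- action of the center -/
def cen (k G : Type*) [Field k] [Group G] [TopologicalSpace G] [IsTopologicalGroup G] :
    Subgroup.center G →* Module.End k (SmoothCc k G) :=
  (ltr k G).comp (Subgroup.center G).subtype

theorem cen_apply (z : Subgroup.center G) (f : SmoothCc k G) : cen k G z f = ltr k G z.1 f := rfl

theorem cen_ltr (z : Subgroup.center G) (g : G) (f : SmoothCc k G) :
    cen k G z (ltr k G g f) = ltr k G g (cen k G z f) := by
  rw [cen_apply, cen_apply, ← Module.End.mul_apply, ← Module.End.mul_apply, ← map_mul, ← map_mul,
    Subgroup.mem_center_iff.mp z.2 g]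

theorem cen_rtr (z : Subgroup.center G) (g : G) (f : SmoothCc k G) :
    cen k G z (rtr g f) = rtr g (cen k G z f) := by
  apply Subtype.ext
  funext x
  simp [cen_apply, ltr_apply, rtr_apply, mul_assoc]

theorem rtr_add (g : G) (f h : SmoothCc k G) : rtr g (f + h) = rtr g f + rtr g h := rfl

theorem rtr_smul (g : G) (c : k) (f : SmoothCc k G) : rtr g (c • f) = c • rtr g f := rfl

theorem act_ltr (a : MonoidAlgebra k (Subgroup.center G)) (g : G) (f : SmoothCc k G) :
    act (cen k G) a (ltr k G g f) = ltr k G g (act (cen k G) a f) := by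
  induction a using MonoidAlgebra.induction_on with
  | of w => simp only [act, MonoidAlgebra.lift_of]; exact cen_ltr w g f
  | add x y hx hy => rw [map_add, LinearMap.add_apply, LinearMap.add_apply, map_add, hx, hy]
  | smul r x hx => rw [map_smul, LinearMap.smul_apply, LinearMap.smul_apply, map_smul, hx]

theorem act_rtr (a : MonoidAlgebra k (Subgroup.center G)) (g : G) (f : SmoothCc k G) :
    act (cen k G) a (rtr g f) = rtr g (act (cen k G) a f) := by
  induction a using MonoidAlgebra.induction_on with
  | of w => simp only [act, MonoidAlgebra.lift_of]; exact cen_rtr w g f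
  | add x y hx hy => rw [map_add, LinearMap.add_apply, LinearMap.add_apply, rtr_add, hx, hy]
  | smul r x hx => rw [map_smul, LinearMap.smul_apply, LinearMap.smul_apply, rtr_smul, hx]

theorem act_eval [T2Space G] (U : Subgroup G) (hc : IsCompact (U : Set G))
    (ho : IsOpen (U : Set G)) (a : MonoidAlgebra k (Subgroup.center G))
    (z : Subgroup.center G) :
    (act (cen k G) a (ind k U hc ho)).1 z.1 =
      (prj k (U.subgroupOf (Subgroup.center G)) a).coeff (QuotientGroup.mk z) := by
  classical
  induction a using MonoidAlgebra.induction_on with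
  | of w =>
    simp only [act, MonoidAlgebra.lift_of]
    rw [cen_apply, ltr_apply, ind_apply]
    have h1 : prj k (U.subgroupOf (Subgroup.center G)) (MonoidAlgebra.of k _ w)
      = MonoidAlgebra.single (QuotientGroup.mk w) 1 := by simp [prj]
    rw [h1, MonoidAlgebra.coeff_single, Finsupp.single_apply]
    apply if_congr _ rfl rfl
    rw [QuotientGroup.eq]
    rfl
  | add x y hx hy =>
    rw [map_add, map_add, LinearMap.add_apply, MonoidAlgebra.coeff_add, Finsupp.add_apply,
      ← hx, ← hy]
    rfl
  | smul r x hx =>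
    rw [map_smul, map_smul, LinearMap.smul_apply, MonoidAlgebra.coeff_smul, Finsupp.smul_apply,
      ← hx]
    rfl

theorem prj_eq_of_act [T2Space G] (U : Subgroup G) (hc : IsCompact (U : Set G))
    (ho : IsOpen (U : Set G)) (a b : MonoidAlgebra k (Subgroup.center G))
    (h : act (cen k G) a (ind k U hc ho) = act (cen k G) b (ind k U hc ho)) :
    prj k (U.subgroupOf (Subgroup.center G)) a = prj k (U.subgroupOf (Subgroup.center G)) b := by
  ext q
  obtain ⟨z, rfl⟩ := QuotientGroup.mk_surjective q
  rw [← act_eval U hc ho, ← act_eval U hc ho, h]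

theorem cen_fixed (U : Subgroup G) (f : SmoothCc k G) (hf : ∀ x, ∀ v ∈ U, f.1 (x * v) = f.1 x)
    (z : Subgroup.center G) (hz : z ∈ U.subgroupOf (Subgroup.center G)) : cen k G z f = f := by
  apply Subtype.ext
  funext x
  rw [cen_apply, ltr_apply]
  have h1 : z.1⁻¹ * x = x * z.1⁻¹ :=
    (Subgroup.mem_center_iff.mp ((Subgroup.center G).inv_mem z.2) x).symm
  rw [h1]
  exact hf x _ (U.inv_mem hz)

theorem sub_co [T2Space G] (U : Subgroup G) (hc : IsCompact (U : Set G))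
    (ho : IsOpen (U : Set G)) :
    IsCompact ((U.subgroupOf (Subgroup.center G) : Subgroup (Subgroup.center G)) :
      Set (Subgroup.center G)) ∧
    IsOpen ((U.subgroupOf (Subgroup.center G) : Subgroup (Subgroup.center G)) :
      Set (Subgroup.center G)) := by
  constructor
  · have hcl : IsClosed ((Subgroup.center G : Subgroup G) : Set G) := by
      have : ((Subgroup.center G : Subgroup G) : Set G) = ⋂ g : G, {z | g * z = z * g} := by
        ext z
        simp [Subgroup.mem_center_iff]
      rw [this]
      exact isClosed_iInter fun g => isClosed_eq (by fun_prop) (by fun_prop)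
    exact hcl.isClosedEmbedding_subtypeVal.isCompact_preimage hc
  · exact ho.preimage continuous_subtype_val

theorem ind_rinv [T2Space G] (U V : Subgroup G) (hc : IsCompact (U : Set G))
    (ho : IsOpen (U : Set G)) (hVU : V ≤ U) (x v : G) (hv : v ∈ V) :
    (ind k U hc ho).1 (x * v) = (ind k U hc ho).1 x := by
  classical
  rw [ind_apply, ind_apply]
  apply if_congr _ rfl rfl
  exact Subgroup.mul_mem_cancel_right _ (hVU hv)

theorem exists_a [T2Space G] [TotallyDisconnectedSpace G] (p : ℕ) (hp : p.Prime) [CharP k p]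
    (U₀ : Subgroup G)
    (hc : IsCompact (U₀ : Set G)) (ho : IsOpen (U₀ : Set G))
    (hpro : ∀ (V : Subgroup U₀) [V.Normal], IsOpen (V : Set U₀) → IsPGroup p (U₀ ⧸ V))
    (hG : ∀ y : G, IsOpen ((Subgroup.centralizer {y} : Subgroup G) : Set G) →
      y ∈ Subgroup.center G)
    {T : Module.End k (SmoothCc k G)} (hT : CommutesLeft T) (hT' : CommutesRight T)
    (U : Subgroup G) (hU : Good U₀ U) :
    ∃ a : MonoidAlgebra k (Subgroup.center G), ∀ f : SmoothCc k G,
      (∀ x, ∀ v ∈ U, f.1 (x * v) = f.1 x) → T f = act (cen k G) a f := by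
  set iU := ind k (U : Set G) (hU.compact hc) hU.2.1 with hiU
  have h1 : ∃ a : MonoidAlgebra k (Subgroup.center G), T iU = act (cen k G) a iU := by
    let R : Submodule k (SmoothCc k G) :=
      LinearMap.range ((LinearMap.applyₗ iU).comp (act (cen k G)).toLinearMap)
    suffices T iU ∈ R by
      obtain ⟨a, ha⟩ := this
      exact ⟨a, ha.symm⟩
    obtain ⟨S, hS⟩ := decomp U (hU.compact hc) hU.2.1 (T iU)
      (fun x v hv => T_right U _ _ hT' v hv x)
    rw [hS]
    apply Submodule.sum_mem
    intro q _
    by_cases hq : (T iU).1 q.out = 0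
    · rw [hq, zero_smul]
      exact R.zero_mem
    · apply R.smul_mem
      obtain ⟨u, hu, hz⟩ := supp p hp U₀ hc ho hpro hG hT hT' U hU q.out hq
      refine ⟨MonoidAlgebra.of k _ ⟨_, hz⟩, ?_⟩
      change act (cen k G) (MonoidAlgebra.of k _ ⟨_, hz⟩) iU = _
      simp only [act, MonoidAlgebra.lift_of]
      rw [cen_apply]
      apply ind_left
      have e : (u⁻¹ * q.out)⁻¹ * q.out = u := by
        have := Subgroup.mem_center_iff.mp hz u
        have h2 : q.out = (u⁻¹ * q.out) * u := by rw [← this]; group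
        rw [inv_mul_eq_iff_eq_mul]
        exact h2
      change (u⁻¹ * q.out)⁻¹ * q.out ∈ U
      rw [e]
      exact hu
  obtain ⟨a, ha⟩ := h1
  refine ⟨a, fun f hf => ?_⟩
  obtain ⟨S, hS⟩ := decomp U (hU.compact hc) hU.2.1 f hf
  rw [hS, map_sum, map_sum]
  apply Finset.sum_congr rfl
  intro q _
  rw [map_smul, map_smul, comm_ltr hT, act_ltr, ha]

end Final

end BC

/-- Let `p` be a prime, `k` a field of characteristic `p`, and `G` a
locally profinite group containing an open pro-`p` subgroup and no proper open
centralisers.  Then the `k`-algebra `B` of endomorphisms of `C_c^∞(G,k)` commuting with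
both the left and the right translation actions of `G` (the Bernstein center) is
isomorphic as a `k`-algebra to `k̂[Z(G)] = lim_{Z'} k[Z(G)/Z']`: there is an injective
`k`-algebra homomorphism `k̂[Z(G)] → End_k(C_c^∞(G,k))` with image exactly `B`. -/
theorem stmt_17 (p : ℕ) (hp : p.Prime) (k G : Type*) [Field k] [CharP k p]
    [Group G] [TopologicalSpace G] [IsTopologicalGroup G]
    [LocallyCompactSpace G] [T2Space G] [TotallyDisconnectedSpace G]
    (hpro : ∃ U : Subgroup G, IsCompact (U : Set G) ∧ IsOpen (U : Set G) ∧
      ∀ (V : Subgroup U) [V.Normal], IsOpen (V : Set U) → IsPGroup p (U ⧸ V))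
    (hG : ∀ y : G, IsOpen ((Subgroup.centralizer {y} : Subgroup G) : Set G) →
      y ∈ Subgroup.center G) :
    ∃ Φ : hatGroupAlgebra k (Subgroup.center G) →ₐ[k] Module.End k (SmoothCc k G),
      Function.Injective Φ ∧
        Set.range Φ = {T | CommutesLeft T ∧ CommutesRight T} := by
  classical
  obtain ⟨U₀, hc, ho, hpro⟩ := hpro
  let CO := {H : Subgroup (Subgroup.center G) // IsCompact (H : Set (Subgroup.center G)) ∧
    IsOpen (H : Set (Subgroup.center G))}
  obtain ⟨Φ, hΦ⟩ := BC.exists_Phi (BC.cen k G) (by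
    intro f
    obtain ⟨V, hV, hf⟩ := BC.exists_good_inv U₀ hc ho f
    exact ⟨V.subgroupOf (Subgroup.center G), BC.sub_co V (hV.compact hc) hV.2.1,
      fun z hz => BC.cen_fixed V f hf z hz⟩)
  have hsmall : ∀ H : CO, ∃ V, BC.Good U₀ V ∧ V.subgroupOf (Subgroup.center G) ≤ H.1 := by
    intro H
    obtain ⟨S, hS, hSH⟩ := isOpen_induced_iff.mp H.2.2
    have h1 : (1 : G) ∈ S := by
      have : (1 : Subgroup.center G) ∈ (H.1 : Set (Subgroup.center G)) := H.1.one_mem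
      rw [← hSH] at this
      exact this
    obtain ⟨V, hV, hVS⟩ := BC.good_basis U₀ hc ho S (hS.mem_nhds h1)
    refine ⟨V, hV, fun z hz => ?_⟩
    have : z ∈ Subtype.val ⁻¹' S := hVS hz
    rw [hSH] at this
    exact this
  refine ⟨Φ, ?_, ?_⟩
  · rw [injective_iff_map_eq_zero]
    intro x hx
    apply Subtype.ext
    funext H
    obtain ⟨V, hV, hVH⟩ := hsmall H
    let K : CO := ⟨V.subgroupOf (Subgroup.center G), BC.sub_co V (hV.compact hc) hV.2.1⟩
    obtain ⟨a, ha⟩ := BC.prj_surj K.1 (x.1 K)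
    have h1 := hΦ x K (BC.ind k (V : Set G) (hV.compact hc) hV.2.1)
      (fun z hz => BC.cen_fixed V _
        (fun y v hv => BC.ind_rinv V V (hV.compact hc) hV.2.1 le_rfl y v hv) z hz) a ha
    have h2 := BC.prj_eq_of_act V (hV.compact hc) hV.2.1 a 0 (by
      rw [← h1, hx, map_zero])
    have h3 : x.1 K = 0 := by
      rw [← ha]
      exact h2.trans (map_zero _)
    rw [← x.2 K H hVH, h3, map_zero]
    rfl
  · ext T
    constructor
    · rintro ⟨x, rfl⟩
      have hex : ∀ f : SmoothCc k G, ∃ (a : MonoidAlgebra k (Subgroup.center G)) (H : CO),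
          (∀ z ∈ H.1, BC.cen k G z f = f) ∧ BC.prj k H.1 a = x.1 H := by
        intro f
        obtain ⟨V, hV, hf⟩ := BC.exists_good_inv U₀ hc ho f
        let K : CO := ⟨V.subgroupOf (Subgroup.center G), BC.sub_co V (hV.compact hc) hV.2.1⟩
        obtain ⟨a, ha⟩ := BC.prj_surj K.1 (x.1 K)
        exact ⟨a, K, fun z hz => BC.cen_fixed V f hf z hz, ha⟩
      constructor
      · intro g f h hh y
        have e : h = BC.ltr k G g f := Subtype.ext (funext hh)
        obtain ⟨a, H, hfix, ha⟩ := hex f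
        rw [e, hΦ x H f hfix a ha, hΦ x H (BC.ltr k G g f) (fun z hz => by
          rw [BC.cen_ltr, hfix z hz]) a ha, BC.act_ltr]
        rfl
      · intro g f h hh y
        have e : h = BC.rtr g f := Subtype.ext (funext hh)
        obtain ⟨a, H, hfix, ha⟩ := hex f
        rw [e, hΦ x H f hfix a ha, hΦ x H (BC.rtr g f) (fun z hz => by
          rw [BC.cen_rtr, hfix z hz]) a ha, BC.act_rtr]
        rfl
    · rintro ⟨hT, hT'⟩
      have hexa := fun U hU => BC.exists_a p hp U₀ hc ho hpro hG hT hT' U hU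
      choose a ha using hexa
      -- independence of the choice of `U`
      have hind : ∀ (U V : Subgroup G) (hU : BC.Good U₀ U) (hV : BC.Good U₀ V), V ≤ U →
          BC.prj k (U.subgroupOf (Subgroup.center G)) (a V hV)
            = BC.prj k (U.subgroupOf (Subgroup.center G)) (a U hU) := by
        intro U V hU hV hVU
        apply BC.prj_eq_of_act U (hU.compact hc) hU.2.1
        rw [← ha V hV _ (fun y v hv => BC.ind_rinv U V (hU.compact hc) hU.2.1 hVU y v hv),
          ← ha U hU _ (fun y v hv => BC.ind_rinv U U (hU.compact hc) hU.2.1 le_rfl y v hv)]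
      have hind2 : ∀ (H : CO) (U V : Subgroup G) (hU : BC.Good U₀ U) (hV : BC.Good U₀ V), V ≤ U →
          U.subgroupOf (Subgroup.center G) ≤ H.1 →
          BC.prj k H.1 (a V hV) = BC.prj k H.1 (a U hU) := by
        intro H U V hU hV hVU hUH
        have h1 := hind U V hU hV hVU
        have hUH' : U.subgroupOf (Subgroup.center G) ≤ H.1.comap (MonoidHom.id _) := hUH
        rw [← BC.map_prj (U.subgroupOf (Subgroup.center G)) H.1 hUH', h1, BC.map_prj]
      have hind3 : ∀ (H : CO) (U V : Subgroup G) (hU : BC.Good U₀ U) (hV : BC.Good U₀ V),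
          U.subgroupOf (Subgroup.center G) ≤ H.1 → V.subgroupOf (Subgroup.center G) ≤ H.1 →
          BC.prj k H.1 (a V hV) = BC.prj k H.1 (a U hU) := by
        intro H U V hU hV hUH hVH
        rw [← hind2 H U (U ⊓ V) hU (hU.inf hV) inf_le_left hUH,
          ← hind2 H V (U ⊓ V) hV (hU.inf hV) inf_le_right hVH]
      choose W hW hWH using hsmall
      let x : hatGroupAlgebra k (Subgroup.center G) :=
        ⟨fun H => BC.prj k H.1 (a (W H) (hW H)), by
          intro i j hij
          change MonoidAlgebra.mapDomainAlgHom k k _ (BC.prj k i.1 (a (W i) (hW i)))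
            = BC.prj k j.1 (a (W j) (hW j))
          rw [BC.map_prj]
          exact hind3 j (W j) (W i) (hW j) (hW i) (hWH j) ((hWH i).trans hij)⟩
      refine ⟨x, ?_⟩
      apply LinearMap.ext
      intro f
      obtain ⟨V, hV, hf⟩ := BC.exists_good_inv U₀ hc ho f
      let K : CO := ⟨V.subgroupOf (Subgroup.center G), BC.sub_co V (hV.compact hc) hV.2.1⟩
      rw [hΦ x K f (fun z hz => BC.cen_fixed V f hf z hz) (a V hV)
        (hind3 K (W K) V (hW K) hV (hWH K) le_rfl), ← ha V hV f hf]
end
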